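/- The integral operator preserves the difference-quotient spaces: fix η > 0, m, l ∈ ℕ, and a nondecreasing ω : (0,∞) → (0,∞). Define C^{m,l,ω} as the space of B ∈ C^m(B^n(η); 𝕄^{n×n}) with finite norm Σ_{|β|≤m} Σ_{j=0}^{l} sup_{(x,h)∈Ω_j} ω(|h|)^{−j} ‖Δ_h^j ∂_x^β B(x)‖, where Ω_j := {(x,h) : x, x+h, …, x+jh ∈ B^n(η), h ≠ 0} and Δ_h B(x) := B(x+h) − B(x). Then for B ∈ C^{m,l,ω}, the function x ↦ ∫₀¹ B(sx) ds belongs to C^{m,l,ω}, with norm bounded by that of B. -/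

import Mathlib

open Metric intervalIntegral

/-- The iterated coordinate partial derivative `∂_x^β B` for an ordered
multi-index (list of coordinate directions) `β`. -/
noncomputable def pderivList {N : ℕ} {V : Type*} [NormedAddCommGroup V]
    [NormedSpace ℝ V] :
    List (Fin N) → (EuclideanSpace ℝ (Fin N) → V) → (EuclideanSpace ℝ (Fin N) → V)
  | [], B => B
  | i :: L, B => fun x => fderiv ℝ (pderivList L B) x (EuclideanSpace.single i 1)

/-- The iterated difference operator `Δ_h^j B(x)`, where `Δ_h B(x) = B(x+h) − B(x)`. -/
def iterDiff {N : ℕ} {V : Type*} [AddCommGroup V] :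
    ℕ → EuclideanSpace ℝ (Fin N) → (EuclideanSpace ℝ (Fin N) → V) →
      (EuclideanSpace ℝ (Fin N) → V)
  | 0, _, B => B
  | j + 1, h, B => fun x => iterDiff j h B (x + h) - iterDiff j h B x

open Set Filter Topology MeasureTheory

section RadialMean

universe u

variable {E V : Type u} [NormedAddCommGroup E] [NormedSpace ℝ E]
  [NormedAddCommGroup V] [NormedSpace ℝ V] {η : ℝ}

/-- The weighted radial mean `∫₀¹ sᵏ f(sx) ds`. -/
noncomputable def radialMean {E V : Type*} [NormedAddCommGroup E] [NormedSpace ℝ E]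
    [NormedAddCommGroup V] [NormedSpace ℝ V] (k : ℕ) (f : E → V) (x : E) : V :=
  ∫ s in (0 : ℝ)..1, s ^ k • f (s • x)

theorem smul_mem_ball_zero {r s : ℝ} {x : E} (hs : s ∈ Icc (0 : ℝ) 1)
    (hx : x ∈ ball (0 : E) r) : s • x ∈ ball (0 : E) r := by
  rw [mem_ball_zero_iff] at hx ⊢
  calc ‖s • x‖ = s * ‖x‖ := by rw [norm_smul, Real.norm_of_nonneg hs.1]
    _ ≤ ‖x‖ := mul_le_of_le_one_left (norm_nonneg x) hs.2
    _ < r := hx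

theorem ContinuousOn.pow_smul_comp_smul {f : E → V} (hf : ContinuousOn f (ball 0 η)) (k : ℕ)
    {x : E} (hx : x ∈ ball (0 : E) η) :
    ContinuousOn (fun s : ℝ => s ^ k • f (s • x)) (uIcc 0 1) := by
  rw [uIcc_of_le zero_le_one]
  exact (continuousOn_pow k).smul
    (hf.comp (by fun_prop) fun s hs => smul_mem_ball_zero hs hx)

theorem exists_nhds_bound_comp_smul [ProperSpace E] {f : E → V}
    (hf : ContinuousOn f (ball 0 η)) (k : ℕ) {x₀ : E} (hx₀ : x₀ ∈ ball (0 : E) η) :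
    ∃ r C : ℝ, r ≤ η ∧ x₀ ∈ ball (0 : E) r ∧
      ∀ s ∈ Icc (0 : ℝ) 1, ∀ x ∈ ball (0 : E) r, ‖s ^ k • f (s • x)‖ ≤ C := by
  obtain ⟨r, hr, hrη⟩ := exists_between (mem_ball_zero_iff.1 hx₀)
  obtain ⟨C, hC⟩ := (isCompact_closedBall (0 : E) r).exists_bound_of_continuousOn
    (hf.mono (closedBall_subset_ball hrη))
  refine ⟨r, C, hrη.le, mem_ball_zero_iff.2 hr, fun s hs x hx => ?_⟩
  rw [norm_smul, norm_pow, Real.norm_of_nonneg hs.1]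
  exact (mul_le_of_le_one_left (norm_nonneg _) (pow_le_one₀ hs.1 hs.2)).trans
    (hC _ (ball_subset_closedBall (smul_mem_ball_zero hs hx)))

theorem aestronglyMeasurable_pow_smul_comp_smul {f : E → V} (hf : ContinuousOn f (ball 0 η))
    (k : ℕ) {x : E} (hx : x ∈ ball (0 : E) η) :
    AEStronglyMeasurable (fun s : ℝ => s ^ k • f (s • x))
      (volume.restrict (uIoc (0 : ℝ) 1)) :=
  ((hf.pow_smul_comp_smul k hx).mono uIoc_subset_uIcc).aestronglyMeasurable measurableSet_uIoc

theorem ContinuousOn.radialMean [ProperSpace E] {f : E → V}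
    (hf : ContinuousOn f (ball 0 η)) (k : ℕ) :
    ContinuousOn (radialMean k f) (ball 0 η) := by
  intro x₀ hx₀
  obtain ⟨r, C, -, hr, hC⟩ := exists_nhds_bound_comp_smul hf k hx₀
  refine (continuousAt_of_dominated_interval (bound := fun _ => C) ?_ ?_
    intervalIntegrable_const ?_).continuousWithinAt
  · filter_upwards [isOpen_ball.mem_nhds hx₀] with x hx
    exact aestronglyMeasurable_pow_smul_comp_smul hf k hx
  · filter_upwards [isOpen_ball.mem_nhds hr] with x hx
    refine .of_forall fun s hs => hC s ?_ x hx
    rw [uIoc_of_le zero_le_one] at hs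
    exact Ioc_subset_Icc_self hs
  · refine .of_forall fun s hs => ?_
    rw [uIoc_of_le zero_le_one] at hs
    have hfs : ContinuousAt f (s • x₀) := hf.continuousAt
      (isOpen_ball.mem_nhds (smul_mem_ball_zero (Ioc_subset_Icc_self hs) hx₀))
    exact (ContinuousAt.comp (f := fun x : E => s • x) hfs (by fun_prop)).const_smul _

theorem hasFDerivAt_radialMean [ProperSpace E] {f : E → V}
    (hf : ContDiffOn ℝ 1 f (ball 0 η)) (k : ℕ) {x₀ : E} (hx₀ : x₀ ∈ ball (0 : E) η) :
    HasFDerivAt (radialMean k f) (radialMean (k + 1) (fderiv ℝ f) x₀) x₀ := by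
  have hf' : ContinuousOn (fderiv ℝ f) (ball 0 η) :=
    hf.continuousOn_fderiv_of_isOpen isOpen_ball le_rfl
  obtain ⟨r, C, hrη, hr, hC⟩ := exists_nhds_bound_comp_smul hf' (k + 1) hx₀
  refine hasFDerivAt_integral_of_dominated_of_fderiv_le (bound := fun _ => C)
    (F' := fun x s => s ^ (k + 1) • fderiv ℝ f (s • x)) (isOpen_ball.mem_nhds hr) ?_
    (hf.continuousOn.pow_smul_comp_smul k hx₀).intervalIntegrable
    (aestronglyMeasurable_pow_smul_comp_smul hf' (k + 1) hx₀) ?_ intervalIntegrable_const ?_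
  · filter_upwards [isOpen_ball.mem_nhds hx₀] with x hx
    exact aestronglyMeasurable_pow_smul_comp_smul hf.continuousOn k hx
  · refine .of_forall fun s hs => hC s ?_
    rw [uIoc_of_le zero_le_one] at hs
    exact Ioc_subset_Icc_self hs
  · refine .of_forall fun s hs x hx => ?_
    rw [uIoc_of_le zero_le_one] at hs
    have hsx := smul_mem_ball_zero (Ioc_subset_Icc_self hs) (ball_subset_ball hrη hx)
    have hfs : HasFDerivAt f (fderiv ℝ f (s • x)) (s • x) :=
      ((hf.differentiableOn one_ne_zero).differentiableAt
        (isOpen_ball.mem_nhds hsx)).hasFDerivAt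
    have hsmul : HasFDerivAt (fun y : E => s • y) (s • ContinuousLinearMap.id ℝ E) x :=
      (hasFDerivAt_id x).const_smul s
    have heq : s ^ k • (fderiv ℝ f (s • x)).comp (s • ContinuousLinearMap.id ℝ E) =
        s ^ (k + 1) • fderiv ℝ f (s • x) := by
      ext v
      simp [pow_succ, mul_smul]
    exact heq ▸ (hfs.comp x hsmul).const_smul (s ^ k)

theorem ContDiffOn.radialMean {E V : Type u} [NormedAddCommGroup E] [NormedSpace ℝ E]
    [ProperSpace E] [NormedAddCommGroup V] [NormedSpace ℝ V] {m : ℕ} {f : E → V}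
    (hf : ContDiffOn ℝ m f (ball 0 η)) (k : ℕ) :
    ContDiffOn ℝ m (radialMean k f) (ball 0 η) := by
  induction m generalizing V k with
  | zero =>
    simp only [Nat.cast_zero, contDiffOn_zero] at hf ⊢
    exact hf.radialMean k
  | succ m ih =>
    have hf₁ : ContDiffOn ℝ 1 f (ball 0 η) := hf.of_le (by exact_mod_cast Nat.le_add_left 1 m)
    rw [Nat.cast_succ, contDiffOn_succ_iff_fderiv_of_isOpen isOpen_ball] at hf ⊢
    refine ⟨fun x hx => (hasFDerivAt_radialMean hf₁ k hx).differentiableAt.differentiableWithinAt,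
      fun h => absurd h (by simp), ?_⟩
    exact (ih hf.2.2 (k + 1)).congr fun x hx => (hasFDerivAt_radialMean hf₁ k hx).fderiv

end RadialMean

section IteratedOperators

variable {N : ℕ} {V : Type} [NormedAddCommGroup V] [NormedSpace ℝ V] {η : ℝ}

theorem ContDiffOn.pderivList {f : EuclideanSpace ℝ (Fin N) → V} (L : List (Fin N)) {n : ℕ}
    (hf : ContDiffOn ℝ (n + L.length : ℕ) f (ball 0 η)) :
    ContDiffOn ℝ n (pderivList L f) (ball 0 η) := by
  induction L generalizing n with
  | nil => exact hf
  | cons i L ih =>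
    have h : ContDiffOn ℝ (n + 1 : ℕ) (_root_.pderivList L f) (ball 0 η) := by
      refine ih ?_
      rwa [List.length_cons, Nat.add_comm L.length, ← Nat.add_assoc] at hf
    exact (h.fderiv_of_isOpen isOpen_ball (by norm_cast)).clm_apply contDiffOn_const

theorem pderivList_radialMean_zero [CompleteSpace V] {f : EuclideanSpace ℝ (Fin N) → V}
    (L : List (Fin N)) (hf : ContDiffOn ℝ L.length f (ball 0 η)) :
    EqOn (pderivList L (radialMean 0 f)) (radialMean L.length (pderivList L f)) (ball 0 η) := by
  induction L with
  | nil => exact fun _ _ => rfl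
  | cons i L ih =>
    intro x hx
    have hL : ContDiffOn ℝ 1 (pderivList L f) (ball 0 η) := by
      refine mod_cast ContDiffOn.pderivList L (n := 1) ?_
      rwa [Nat.add_comm]
    have hev : pderivList L (radialMean 0 f) =ᶠ[𝓝 x] radialMean L.length (pderivList L f) :=
      (ih (hf.of_le (by simp))).eventuallyEq_of_mem (isOpen_ball.mem_nhds hx)
    have hint := ((hL.continuousOn_fderiv_of_isOpen isOpen_ball le_rfl).pow_smul_comp_smul
      (L.length + 1) hx).intervalIntegrable (μ := volume)
    change fderiv ℝ (pderivList L (radialMean 0 f)) x _ = _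
    rw [hev.fderiv_eq, (hasFDerivAt_radialMean hL L.length hx).fderiv]
    exact ContinuousLinearMap.intervalIntegral_apply hint _

theorem Set.EqOn.iterDiff_eq {V : Type*} [AddCommGroup V] {f g : EuclideanSpace ℝ (Fin N) → V}
    {s : Set (EuclideanSpace ℝ (Fin N))} (hfg : EqOn f g s) (j : ℕ)
    {x h : EuclideanSpace ℝ (Fin N)} (hx : ∀ i : ℕ, i ≤ j → x + (i : ℝ) • h ∈ s) :
    iterDiff j h f x = iterDiff j h g x := by
  induction j generalizing x with
  | zero => exact hfg (by simpa using hx 0 le_rfl)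
  | succ j ih =>
    simp only [iterDiff]
    rw [ih fun i hi => hx i (by omega), ih fun i hi => ?_]
    have := hx (i + 1) (by omega)
    rwa [Nat.cast_succ, add_smul, one_smul, add_comm ((i : ℝ) • h), ← add_assoc] at this

theorem iterDiff_radialMean {f : EuclideanSpace ℝ (Fin N) → V}
    (hf : ContinuousOn f (ball 0 η)) (k j : ℕ) {x h : EuclideanSpace ℝ (Fin N)}
    (hx : ∀ i : ℕ, i ≤ j → x + (i : ℝ) • h ∈ ball (0 : EuclideanSpace ℝ (Fin N)) η) :
    IntervalIntegrable (fun s : ℝ => s ^ k • iterDiff j (s • h) f (s • x)) volume 0 1 ∧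
      iterDiff j h (radialMean k f) x =
        ∫ s in (0 : ℝ)..1, s ^ k • iterDiff j (s • h) f (s • x) := by
  induction j generalizing x with
  | zero =>
    exact ⟨(hf.pow_smul_comp_smul k (by simpa using hx 0 le_rfl)).intervalIntegrable, rfl⟩
  | succ j ih =>
    obtain ⟨hi₁, he₁⟩ := ih (x := x) fun i hi => hx i (by omega)
    obtain ⟨hi₂, he₂⟩ := ih (x := x + h) fun i hi => by
      have := hx (i + 1) (by omega)
      rwa [Nat.cast_succ, add_smul, one_smul, add_comm ((i : ℝ) • h), ← add_assoc] at this
    simp only [smul_add] at hi₂ he₂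
    simp only [iterDiff, smul_sub]
    exact ⟨hi₂.sub hi₁, by rw [he₁, he₂, integral_sub hi₂ hi₁]⟩

end IteratedOperators

/-- The operator `B ↦ ∫₀¹ B(sx) ds` preserves the
difference-quotient spaces `C^{m,l,ω}` on `Bⁿ(η)` (matrix-valued functions,
with `𝕄^{n×n}` modelled as endomorphisms of `ℝ^ν` with the operator norm):
componentwise, if `‖Δ_h^j ∂_x^β B(x)‖ ≤ ω(|h|)^j K(β,j)` for all `|β| ≤ m`,
`j ≤ l` and admissible `(x,h)`, then the same bounds hold for
`G(x) = ∫₀¹ B(sx) ds`, and `G ∈ C^m`. -/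
theorem integral_operator_preserves_Cmlomega
    (NN ν : ℕ) (η : ℝ) (hη : 0 < η) (m l : ℕ) (ω : ℝ → ℝ)
    (hωmono : ∀ a b : ℝ, 0 < a → a ≤ b → ω a ≤ ω b)
    (hωpos : ∀ t : ℝ, 0 < t → 0 < ω t)
    (B : EuclideanSpace ℝ (Fin NN) →
      (EuclideanSpace ℝ (Fin ν) →L[ℝ] EuclideanSpace ℝ (Fin ν)))
    (hB : ContDiffOn ℝ m B (ball 0 η))
    (K : List (Fin NN) → ℕ → ℝ)
    (hK : ∀ L : List (Fin NN), L.length ≤ m → ∀ j ≤ l,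
      ∀ x h : EuclideanSpace ℝ (Fin NN), h ≠ 0 →
      (∀ i : ℕ, i ≤ j → x + (i : ℝ) • h ∈ ball (0 : EuclideanSpace ℝ (Fin NN)) η) →
      ‖iterDiff j h (pderivList L B) x‖ ≤ ω ‖h‖ ^ j * K L j) :
    ContDiffOn ℝ m (fun x => ∫ s in (0:ℝ)..1, B (s • x)) (ball 0 η) ∧
    ∀ L : List (Fin NN), L.length ≤ m → ∀ j ≤ l,
      ∀ x h : EuclideanSpace ℝ (Fin NN), h ≠ 0 →
      (∀ i : ℕ, i ≤ j → x + (i : ℝ) • h ∈ ball (0 : EuclideanSpace ℝ (Fin NN)) η) →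
      ‖iterDiff j h (pderivList L (fun x => ∫ s in (0:ℝ)..1, B (s • x))) x‖ ≤
        ω ‖h‖ ^ j * K L j := by
  have hG : (fun x => ∫ s in (0:ℝ)..1, B (s • x)) = radialMean 0 B := by
    funext x
    simp [radialMean]
  rw [hG]
  refine ⟨hB.radialMean 0, fun L hL j hj x h hh hx => ?_⟩
  have hBL : ContDiffOn ℝ L.length B (ball 0 η) := hB.of_le (by exact_mod_cast hL)
  have hcont : ContinuousOn (pderivList L B) (ball 0 η) :=
    (ContDiffOn.pderivList L (n := 0) (by rwa [Nat.zero_add])).continuousOn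
  have hω : 0 < ω ‖h‖ := hωpos _ (norm_pos_iff.2 hh)
  have hKnonneg : 0 ≤ K L j := nonneg_of_mul_nonneg_right
    ((norm_nonneg _).trans (hK L hL j hj x h hh hx)) (pow_pos hω j)
  rw [(pderivList_radialMean_zero L hBL).iterDiff_eq j hx, (iterDiff_radialMean hcont _ j hx).2]
  suffices hbound : ∀ s ∈ uIoc (0 : ℝ) 1,
      ‖s ^ L.length • iterDiff j (s • h) (pderivList L B) (s • x)‖ ≤ ω ‖h‖ ^ j * K L j by
    simpa using norm_integral_le_of_norm_le_const hbound
  intro s hs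
  rw [uIoc_of_le zero_le_one] at hs
  have hs' := Ioc_subset_Icc_self hs
  have hsh : 0 < ‖s • h‖ := norm_pos_iff.2 (smul_ne_zero hs.1.ne' hh)
  have hle : ‖s • h‖ ≤ ‖h‖ := by
    rw [norm_smul, Real.norm_of_nonneg hs'.1]
    exact mul_le_of_le_one_left (norm_nonneg h) hs.2
  calc ‖s ^ L.length • iterDiff j (s • h) (pderivList L B) (s • x)‖
      ≤ ‖iterDiff j (s • h) (pderivList L B) (s • x)‖ := by
        rw [norm_smul, norm_pow, Real.norm_of_nonneg hs'.1]
        exact mul_le_of_le_one_left (norm_nonneg _) (pow_le_one₀ hs'.1 hs'.2)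
    _ ≤ ω ‖s • h‖ ^ j * K L j := by
        refine hK L hL j hj _ _ (norm_pos_iff.1 hsh) fun i hi => ?_
        rw [smul_comm, ← smul_add]
        exact smul_mem_ball_zero hs' (hx i hi)
    _ ≤ ω ‖h‖ ^ j * K L j := by
        gcongr
        · exact (hωpos _ hsh).le
        · exact hωmono _ _ hsh hle
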